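/- arXiv:2404.19392 — 8 statements merged into one kernel-verified Lean document; each statement's English description precedes it below -/
import Mathlib

section
/- Let X ∈ ℝ^{n×r} satisfy XᵀX = I_r, and let L ∈ ℝ^{n×n} and R ∈ ℝ^{r×r} be symmetric matrices with the property that for every V ∈ ℝ^{n×r} with XᵀV + VᵀX = 0 one also has Xᵀ(LVR) + (LVR)ᵀX = 0. Then for every G ∈ ℝ^{n×r} and every symmetric S ∈ ℝ^{r×r}, the following matrix identity holds: (L G R + X S) − X·sym(Xᵀ(L G R + X S)) = L·(G − X·sym(XᵀG))·R, where sym(M) := (M + Mᵀ)/2. -/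
open Matrix

/-- Symmetric part of a square matrix: `sym(M) = (M + Mᵀ)/2`. -/
noncomputable def symPart {r : ℕ} (M : Matrix (Fin r) (Fin r) ℝ) : Matrix (Fin r) (Fin r) ℝ :=
  (2⁻¹ : ℝ) • (M + Mᵀ)

lemma isSymm_symPart {r : ℕ} (M : Matrix (Fin r) (Fin r) ℝ) : (symPart M).IsSymm := by
  simp [symPart, Matrix.IsSymm, add_comm]

lemma symPart_add_self {r : ℕ} (M : Matrix (Fin r) (Fin r) ℝ) :
    symPart M + symPart M = M + Mᵀ := by
  rw [symPart, ← add_smul]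
  norm_num

/-- Tangent vectors to the Stiefel manifold are trace-orthogonal to normal vectors. -/
lemma trace_transpose_mul_normal_eq_zero {n r : ℕ} {X V : Matrix (Fin n) (Fin r) ℝ}
    (hV : Xᵀ * V + Vᵀ * X = 0) {T : Matrix (Fin r) (Fin r) ℝ} (hT : T.IsSymm) :
    (Vᵀ * (X * T)).trace = 0 := by
  have h₁ : (Vᵀ * (X * T)).trace = (Xᵀ * V * T).trace := by
    rw [← trace_transpose, transpose_mul, transpose_mul, transpose_transpose, hT.eq,
      Matrix.mul_assoc, trace_mul_comm]
  have h₂ : (Xᵀ * V * T).trace + (Vᵀ * (X * T)).trace = 0 := by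
    rw [← Matrix.mul_assoc, ← trace_add, ← Matrix.add_mul, hV, Matrix.zero_mul, trace_zero]
  linarith

/-- The map `Y ↦ Y - X sym(Xᵀ Y)` takes values in the tangent space at `X`. -/
lemma sub_mul_symPart_tangent {n r : ℕ} {X : Matrix (Fin n) (Fin r) ℝ} (hX : Xᵀ * X = 1)
    (Y : Matrix (Fin n) (Fin r) ℝ) :
    Xᵀ * (Y - X * symPart (Xᵀ * Y)) + (Y - X * symPart (Xᵀ * Y))ᵀ * X = 0 := by
  have h := symPart_add_self (Xᵀ * Y)
  rw [transpose_mul, transpose_transpose] at h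
  rw [transpose_sub, transpose_mul, (isSymm_symPart _).eq, Matrix.mul_sub, Matrix.sub_mul,
    ← Matrix.mul_assoc Xᵀ X, hX, Matrix.one_mul, Matrix.mul_assoc _ Xᵀ X, hX, Matrix.mul_one,
    sub_add_sub_comm, h, sub_self]

/-- Lemma 3.2(i) on the Stiefel manifold: if `L`, `R` are symmetric and map tangent
vectors at `X ∈ St(r,n)` to tangent vectors (Assumption (A1)), then the tangent
projection of `L G R + X S` (with `S` symmetric) equals `L · P_{T_X}(G) · R`. -/
theorem tangent_projection_of_scaled_direction {n r : ℕ}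
    (X : Matrix (Fin n) (Fin r) ℝ) (hX : Xᵀ * X = 1)
    (L : Matrix (Fin n) (Fin n) ℝ) (hL : L.IsSymm)
    (R : Matrix (Fin r) (Fin r) ℝ) (hR : R.IsSymm)
    (hA1 : ∀ V : Matrix (Fin n) (Fin r) ℝ, Xᵀ * V + Vᵀ * X = 0 →
      Xᵀ * (L * V * R) + (L * V * R)ᵀ * X = 0)
    (G : Matrix (Fin n) (Fin r) ℝ) (S : Matrix (Fin r) (Fin r) ℝ) (hS : S.IsSymm) :
    (L * G * R + X * S) - X * symPart (Xᵀ * (L * G * R + X * S)) =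
      L * (G - X * symPart (Xᵀ * G)) * R := by
  set T := symPart (Xᵀ * G)
  set U := symPart (Xᵀ * (L * G * R + X * S))
  have hT : T.IsSymm := isSymm_symPart _
  have hU : U.IsSymm := isSymm_symPart _
  rw [← sub_eq_zero]
  set D := L * G * R + X * S - X * U - L * (G - X * T) * R with hD
  have hDtan : Xᵀ * D + Dᵀ * X = 0 := by
    rw [hD, transpose_sub, Matrix.mul_sub, Matrix.sub_mul, sub_add_sub_comm,
      sub_mul_symPart_tangent hX, hA1 _ (sub_mul_symPart_tangent hX G), sub_zero]
  have hDsum : D = L * (X * T) * R + X * (S - U) := by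
    rw [hD, Matrix.mul_sub, Matrix.mul_sub, Matrix.sub_mul]
    abel
  have hscaled : (Dᵀ * (L * (X * T) * R)).trace = 0 := by
    have h := trace_transpose_mul_normal_eq_zero (hA1 D hDtan) hT
    rw [transpose_mul, transpose_mul, hL.eq, hR.eq, Matrix.mul_assoc, trace_mul_comm] at h
    simpa only [Matrix.mul_assoc] using h
  have hnormal := trace_transpose_mul_normal_eq_zero hDtan (hS.sub hU)
  have htrace : (Dᵀ * D).trace = 0 := by
    rw [congrArg (Dᵀ * ·) hDsum, Matrix.mul_add, trace_add, hscaled, hnormal, add_zero]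
  rwa [← conjTranspose_eq_transpose_of_trivial, trace_conjTranspose_mul_self_eq_zero_iff] at htrace
end

section
/- Let 1 ≤ r ≤ n, let X ∈ ℝ^{n×r} satisfy XᵀX = I_r, let δ > 0, let V ∈ ℝ^{n×r} satisfy XᵀV + VᵀX = 0, and let S ∈ ℝ^{r×r} be symmetric with S − (δ−1)·I_r positive semidefinite (i.e., every eigenvalue of S is at least δ−1). Then (X + V + XS)ᵀ(X + V + XS) ≽ δ²·I_r; equivalently, the smallest singular value of X + V + XS is at least δ. -/
open Matrix

/-- Lemma 4.6: for `X ∈ St(r,n)`, a tangent vector `V` at `X` and a symmetric `S`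
with every eigenvalue at least `δ − 1` (i.e. `S − (δ−1)·I ≽ 0`), one has
`(X + V + XS)ᵀ(X + V + XS) ≽ δ²·I`; equivalently `σ_min(X + V + XS) ≥ δ`. -/
theorem singular_value_dominated_by_normal_vector {n r : ℕ} (hr : 1 ≤ r) (hrn : r ≤ n)
    (X : Matrix (Fin n) (Fin r) ℝ) (hX : Xᵀ * X = 1)
    (δ : ℝ) (hδ : 0 < δ)
    (V : Matrix (Fin n) (Fin r) ℝ) (hV : Xᵀ * V + Vᵀ * X = 0)
    (S : Matrix (Fin r) (Fin r) ℝ) (hS : S.IsSymm)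
    (hSδ : (S - (δ - 1) • (1 : Matrix (Fin r) (Fin r) ℝ)).PosSemidef) :
    ((X + V + X * S)ᵀ * (X + V + X * S) -
      (δ ^ 2) • (1 : Matrix (Fin r) (Fin r) ℝ)).PosSemidef := by
  set Y := X + V + X * S with hY
  have hcross : Xᵀ * Y + Yᵀ * X = (2 : ℝ) • (1 + S) := by
    calc Xᵀ * Y + Yᵀ * X
        = Xᵀ * X + Xᵀ * X + (Xᵀ * V + Vᵀ * X) + Xᵀ * X * S + Sᵀ * (Xᵀ * X) := by
          simp only [hY, transpose_add, transpose_mul, Matrix.mul_add, Matrix.add_mul,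
            Matrix.mul_assoc]
          abel
      _ = (2 : ℝ) • (1 + S) := by
          rw [hX, hV, hS.eq, Matrix.one_mul, Matrix.mul_one]
          module
  have hdecomp : Yᵀ * Y - (δ ^ 2) • (1 : Matrix (Fin r) (Fin r) ℝ) =
      (Y - δ • X)ᵀ * (Y - δ • X) +
        (2 * δ) • (S - (δ - 1) • (1 : Matrix (Fin r) (Fin r) ℝ)) := by
    have hexpand : (Y - δ • X)ᵀ * (Y - δ • X) =
        Yᵀ * Y - δ • (Xᵀ * Y + Yᵀ * X) + δ ^ 2 • (Xᵀ * X) := by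
      simp only [transpose_sub, transpose_smul, Matrix.sub_mul, Matrix.mul_sub,
        Matrix.smul_mul, Matrix.mul_smul]
      module
    rw [hexpand, hcross, hX]
    module
  rw [hdecomp]
  refine Matrix.PosSemidef.add ?_ (hSδ.smul (by positivity))
  simpa only [conjTranspose_eq_transpose_of_trivial] using
    posSemidef_conjTranspose_mul_self (Y - δ • X)
end

section
/- Let 1 ≤ r ≤ n, let X, Z ∈ ℝ^{n×r} satisfy XᵀX = ZᵀZ = I_r, let V ∈ ℝ^{n×r} satisfy XᵀV + VᵀX = 0, let S ∈ ℝ^{r×r} be symmetric, and let P ∈ ℝ^{r×r} be symmetric positive semidefinite such that X + V + XS = Z·P (a polar decomposition of X + V + XS). Then ‖V‖ ≤ (r+1)·‖X + V + XS‖·‖Z − X‖, where ‖·‖ denotes the Frobenius norm. -/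
open Matrix

/-- Frobenius norm of a real matrix: `‖A‖ = √(trace (Aᵀ * A))`. -/
noncomputable def frobNorm {m n : ℕ} (A : Matrix (Fin m) (Fin n) ℝ) : ℝ :=
  Real.sqrt (Matrix.trace (Aᵀ * A))

attribute [local instance] Matrix.frobeniusNormedAddCommGroup in
theorem frobNorm_eq_norm {m n : ℕ} (A : Matrix (Fin m) (Fin n) ℝ) : frobNorm A = ‖A‖ := by
  rw [Matrix.frobenius_norm_def, frobNorm, Real.sqrt_eq_rpow, Finset.sum_comm]
  simp [Matrix.trace, Matrix.mul_apply, ← sq]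

attribute [local instance] Matrix.frobeniusNormedAddCommGroup in
theorem frobNorm_mul_le {l m n : ℕ} (A : Matrix (Fin l) (Fin m) ℝ)
    (B : Matrix (Fin m) (Fin n) ℝ) : frobNorm (A * B) ≤ frobNorm A * frobNorm B := by
  simpa only [frobNorm_eq_norm] using Matrix.frobenius_norm_mul A B

theorem frobNorm_nonneg {m n : ℕ} (A : Matrix (Fin m) (Fin n) ℝ) : 0 ≤ frobNorm A :=
  Real.sqrt_nonneg _

theorem trace_transpose_mul_self_nonneg {m n : ℕ} (A : Matrix (Fin m) (Fin n) ℝ) :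
    0 ≤ (Aᵀ * A).trace := by
  simp only [Matrix.trace, Matrix.diag_apply, Matrix.mul_apply, Matrix.transpose_apply]
  exact Finset.sum_nonneg fun _ _ => Finset.sum_nonneg fun _ _ => mul_self_nonneg _

theorem frobNorm_mul_of_transpose_mul_self_eq_one {m n k : ℕ} {Z : Matrix (Fin m) (Fin n) ℝ}
    (hZ : Zᵀ * Z = 1) (P : Matrix (Fin n) (Fin k) ℝ) : frobNorm (Z * P) = frobNorm P := by
  rw [frobNorm, frobNorm, Matrix.transpose_mul, Matrix.mul_assoc, ← Matrix.mul_assoc Zᵀ, hZ,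
    Matrix.one_mul]

theorem trace_mul_eq_zero_of_skew_of_symm {n : ℕ} {A K : Matrix (Fin n) (Fin n) ℝ}
    (hA : Aᵀ = -A) (hK : K.IsSymm) : (A * K).trace = 0 := by
  have h : (A * K).trace = -(A * K).trace := by
    conv_lhs => rw [← Matrix.trace_transpose, Matrix.transpose_mul, hA, hK.eq,
      Matrix.mul_neg, Matrix.trace_neg, Matrix.trace_mul_comm]
  linarith

/-- A tangent vector is no longer than its sum with any normal vector. -/
theorem frobNorm_le_frobNorm_add_mul {n r : ℕ} {X V : Matrix (Fin n) (Fin r) ℝ}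
    {K : Matrix (Fin r) (Fin r) ℝ} (hV : Xᵀ * V + Vᵀ * X = 0) (hK : K.IsSymm) :
    frobNorm V ≤ frobNorm (V + X * K) := by
  have hskew : (Vᵀ * X)ᵀ = -(Vᵀ * X) := by
    rw [Matrix.transpose_mul, Matrix.transpose_transpose]
    exact eq_neg_of_add_eq_zero_left hV
  have h0 : (Vᵀ * (X * K)).trace = 0 := by
    rw [← Matrix.mul_assoc]
    exact trace_mul_eq_zero_of_skew_of_symm hskew hK
  have h1 : ((X * K)ᵀ * V).trace = 0 := by
    rw [← Matrix.trace_transpose, Matrix.transpose_mul, Matrix.transpose_transpose, h0]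
  refine Real.sqrt_le_sqrt ?_
  have h2 := trace_transpose_mul_self_nonneg (X * K)
  rw [Matrix.transpose_add, Matrix.add_mul, Matrix.mul_add, Matrix.mul_add]
  simp only [Matrix.trace_add]
  linarith

/-- Lemma 4.7: for `X, Z ∈ St(r,n)`, `V` tangent at `X`, `S` symmetric, and
`P` symmetric PSD with `X + V + XS = Z P` (polar decomposition), one has
`‖V‖ ≤ (r+1)·‖X + V + XS‖·‖Z − X‖`. -/
theorem first_order_boundedness_lower {n r : ℕ} (hr : 1 ≤ r) (hrn : r ≤ n)
    (X Z V : Matrix (Fin n) (Fin r) ℝ) (S P : Matrix (Fin r) (Fin r) ℝ)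
    (hX : Xᵀ * X = 1) (hZ : Zᵀ * Z = 1)
    (hV : Xᵀ * V + Vᵀ * X = 0)
    (hS : S.IsSymm) (hP : P.PosSemidef)
    (hpolar : X + V + X * S = Z * P) :
    frobNorm V ≤ ((r : ℝ) + 1) * frobNorm (X + V + X * S) * frobNorm (Z - X) := by
  have hPs : P.IsSymm := by simpa [Matrix.IsHermitian, Matrix.IsSymm] using hP.isHermitian
  have hK : (1 + S - P).IsSymm := (Matrix.isSymm_one.add hS).sub hPs
  have hdecomp : V + X * (1 + S - P) = (Z - X) * P := by
    rw [Matrix.sub_mul, ← hpolar, Matrix.mul_sub, Matrix.mul_add, Matrix.mul_one]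
    abel
  have hr0 : (0 : ℝ) ≤ r := r.cast_nonneg
  have hprod : 0 ≤ frobNorm P * frobNorm (Z - X) :=
    mul_nonneg (frobNorm_nonneg _) (frobNorm_nonneg _)
  rw [hpolar, frobNorm_mul_of_transpose_mul_self_eq_one hZ]
  calc frobNorm V ≤ frobNorm ((Z - X) * P) := hdecomp ▸ frobNorm_le_frobNorm_add_mul hV hK
    _ ≤ frobNorm (Z - X) * frobNorm P := frobNorm_mul_le _ _
    _ ≤ (r + 1) * frobNorm P * frobNorm (Z - X) := by nlinarith
end

section
/- Let 0 ≤ p ≤ n, let Y ∈ ℝ^{n×n}, and let X* ∈ Gr(p,n). Then the following are equivalent: (a) for every X ∈ Gr(p,n), ‖Y − X*‖ ≤ ‖Y − X‖; (b) for every X ∈ Gr(p,n), ‖Yᵀ − X*‖ ≤ ‖Yᵀ − X‖; (c) for every X ∈ Gr(p,n), ‖sym(Y) − X*‖ ≤ ‖sym(Y) − X‖, where sym(Y) := (Y + Yᵀ)/2 and ‖·‖ denotes the Frobenius norm. In other words, the projections of Y, Yᵀ and sym(Y) onto Gr(p,n) coincide. -/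
open Matrix

/-- The Grassmann manifold `Gr(p,n)` of rank-`p` orthogonal projection matrices. -/
def Grass {n : ℕ} (p : ℕ) (X : Matrix (Fin n) (Fin n) ℝ) : Prop :=
  X.IsSymm ∧ X * X = X ∧ X.rank = p

theorem frobNorm_transpose {m n : ℕ} (A : Matrix (Fin m) (Fin n) ℝ) :
    frobNorm Aᵀ = frobNorm A := by
  rw [frobNorm, frobNorm, transpose_transpose, trace_mul_comm]

theorem frobNorm_sq {m n : ℕ} (A : Matrix (Fin m) (Fin n) ℝ) :
    frobNorm A ^ 2 = trace (Aᵀ * A) := by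
  refine Real.sq_sqrt ?_
  simp only [trace, diag_apply, mul_apply, transpose_apply]
  exact Finset.sum_nonneg fun i _ => Finset.sum_nonneg fun j _ => mul_self_nonneg _

/-- The symmetric and skew-symmetric parts of a matrix are orthogonal. -/
theorem frobNorm_sq_eq_symm_add_skew {n : ℕ} (A : Matrix (Fin n) (Fin n) ℝ) :
    frobNorm A ^ 2 =
      frobNorm ((2⁻¹ : ℝ) • (A + Aᵀ)) ^ 2 + frobNorm ((2⁻¹ : ℝ) • (A - Aᵀ)) ^ 2 := by
  have h : trace (A * Aᵀ) = trace (Aᵀ * A) := trace_mul_comm _ _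
  simp only [frobNorm_sq, transpose_smul, transpose_add, transpose_sub, transpose_transpose,
    smul_mul, Matrix.mul_smul, Matrix.add_mul, Matrix.mul_add, Matrix.sub_mul, Matrix.mul_sub,
    trace_smul, trace_add, trace_sub, smul_eq_mul, h]
  ring

theorem frobNorm_sub_sq_of_isSymm {n : ℕ} (Y : Matrix (Fin n) (Fin n) ℝ)
    {X : Matrix (Fin n) (Fin n) ℝ} (hX : X.IsSymm) :
    frobNorm (Y - X) ^ 2 =
      frobNorm ((2⁻¹ : ℝ) • (Y + Yᵀ) - X) ^ 2 + frobNorm ((2⁻¹ : ℝ) • (Y - Yᵀ)) ^ 2 := by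
  have hsymm : (2⁻¹ : ℝ) • ((Y - X) + (Y - X)ᵀ) = (2⁻¹ : ℝ) • (Y + Yᵀ) - X := by
    rw [transpose_sub, hX.eq]
    module
  have hskew : (Y - X) - (Y - X)ᵀ = Y - Yᵀ := by
    rw [transpose_sub, hX.eq]
    abel
  rw [frobNorm_sq_eq_symm_add_skew, hsymm, hskew]

theorem frobNorm_transpose_sub_of_isSymm {n : ℕ} (Y : Matrix (Fin n) (Fin n) ℝ)
    {X : Matrix (Fin n) (Fin n) ℝ} (hX : X.IsSymm) :
    frobNorm (Yᵀ - X) = frobNorm (Y - X) := by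
  rw [← frobNorm_transpose (Y - X), transpose_sub, hX.eq]

/-- Lemma 4.8(i): `X*` is a projection of `Y` onto `Gr(p,n)` iff it is a projection
of `Yᵀ` iff it is a projection of `sym(Y) = (Y + Yᵀ)/2`. -/
theorem grassmann_projection_symmetrize {n p : ℕ} (hpn : p ≤ n)
    (Y Xs : Matrix (Fin n) (Fin n) ℝ) (hXs : Grass p Xs) :
    ((∀ X, Grass p X → frobNorm (Y - Xs) ≤ frobNorm (Y - X)) ↔
      (∀ X, Grass p X → frobNorm (Yᵀ - Xs) ≤ frobNorm (Yᵀ - X))) ∧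
    ((∀ X, Grass p X → frobNorm (Yᵀ - Xs) ≤ frobNorm (Yᵀ - X)) ↔
      (∀ X, Grass p X →
        frobNorm ((2⁻¹ : ℝ) • (Y + Yᵀ) - Xs) ≤ frobNorm ((2⁻¹ : ℝ) • (Y + Yᵀ) - X))) := by
  refine ⟨forall₂_congr fun X hX => ?_, forall₂_congr fun X hX => ?_⟩
  · rw [frobNorm_transpose_sub_of_isSymm Y hXs.1, frobNorm_transpose_sub_of_isSymm Y hX.1]
  · rw [frobNorm_transpose_sub_of_isSymm Y hXs.1, frobNorm_transpose_sub_of_isSymm Y hX.1,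
      ← sq_le_sq₀ (frobNorm_nonneg _) (frobNorm_nonneg _),
      frobNorm_sub_sq_of_isSymm Y hXs.1, frobNorm_sub_sq_of_isSymm Y hX.1,
      add_le_add_iff_right, sq_le_sq₀ (frobNorm_nonneg _) (frobNorm_nonneg _)]
end

section
/- Let 0 ≤ p ≤ n, let Y ∈ ℝ^{n×n} be symmetric, let Q ∈ ℝ^{n×n} be orthogonal (QᵀQ = I_n), and let λ₁ ≥ λ₂ ≥ … ≥ λ_n be real numbers such that Y = Q·diag(λ₁,…,λ_n)·Qᵀ. Set X₀ := Q·diag(I_p, 0_{(n−p)×(n−p)})·Qᵀ. Then X₀ ∈ Gr(p,n) and for every X ∈ Gr(p,n) one has ‖Y − X₀‖ ≤ ‖Y − X‖ (Frobenius norm); that is, X₀ is a projection of Y onto Gr(p,n). -/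
open Matrix

lemma trace_eq_rank_of_mul_self {n : ℕ} {X : Matrix (Fin n) (Fin n) ℝ} (hX : X * X = X) :
    X.trace = X.rank := by
  have h : IsIdempotentElem (Matrix.toLin' X) := by
    rw [IsIdempotentElem, Module.End.mul_eq_comp, ← Matrix.toLin'_mul, hX]
  have h2 := (LinearMap.IsIdempotentElem.isProj_range _ h).trace
  rw [Matrix.trace_toLin'_eq] at h2
  exact h2

/-- A symmetric idempotent real matrix has diagonal entries in the unit interval. -/
lemma diag_mem_Icc_of_isSymm_of_mul_self {n : ℕ} {Z : Matrix (Fin n) (Fin n) ℝ}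
    (hs : Z.IsSymm) (hZ : Z * Z = Z) (i : Fin n) : Z i i ∈ Set.Icc (0 : ℝ) 1 := by
  have h : Z i i = ∑ j, Z i j ^ 2 := by
    conv_lhs => rw [← hZ, Matrix.mul_apply]
    exact Finset.sum_congr rfl fun j _ => by rw [hs.apply i j, sq]
  have h0 : 0 ≤ Z i i := h ▸ Finset.sum_nonneg fun j _ => sq_nonneg _
  have h1 : Z i i ^ 2 ≤ Z i i := by
    conv_rhs => rw [h]
    exact Finset.single_le_sum (f := fun j => Z i j ^ 2) (fun j _ => sq_nonneg _)
      (Finset.mem_univ i)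
  exact ⟨h0, by nlinarith⟩

lemma Antitone.exists_threshold {n : ℕ} {lam : Fin n → ℝ} (hlam : Antitone lam) (p : ℕ) :
    ∃ c : ℝ, ∀ i : Fin n, if (i : ℕ) < p then c ≤ lam i else lam i ≤ c := by
  by_cases hp : p < n
  · refine ⟨lam ⟨p, hp⟩, fun i => ?_⟩
    split_ifs with hi
    · exact hlam (Fin.mk_le_mk.2 hi.le)
    · exact hlam (Fin.mk_le_mk.2 (not_lt.1 hi))
  · rcases Nat.eq_zero_or_pos n with rfl | hn
    · exact ⟨0, fun i => i.elim0⟩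
    · refine ⟨lam ⟨n - 1, by omega⟩, fun i => ?_⟩
      rw [if_pos (by omega)]
      exact hlam (Fin.mk_le_mk.2 (by omega))

/-- Among weights in `[0, 1]` of total mass `p`, the indicator of the first `p` indices maximizes
the weighted sum of an antitone sequence. -/
lemma Antitone.sum_mul_le_sum_mul_indicator {n p : ℕ} {lam : Fin n → ℝ} (hlam : Antitone lam)
    {z : Fin n → ℝ} (hz : ∀ i, z i ∈ Set.Icc (0 : ℝ) 1)
    (hsum : ∑ i, z i = ∑ i : Fin n, if (i : ℕ) < p then (1 : ℝ) else 0) :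
    ∑ i, lam i * z i ≤ ∑ i : Fin n, lam i * if (i : ℕ) < p then (1 : ℝ) else 0 := by
  obtain ⟨c, hc⟩ := hlam.exists_threshold p
  have key : ∑ i, (lam i - c) * z i ≤
      ∑ i : Fin n, (lam i - c) * if (i : ℕ) < p then (1 : ℝ) else 0 := by
    refine Finset.sum_le_sum fun i _ => ?_
    obtain ⟨h0, h1⟩ := hz i
    have hi := hc i
    split_ifs at hi ⊢ <;> nlinarith
  simp only [sub_mul, Finset.sum_sub_distrib, ← Finset.mul_sum] at key
  rw [hsum] at key
  linarith

lemma sum_indicator_lt {n p : ℕ} (hpn : p ≤ n) :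
    ∑ i : Fin n, (if (i : ℕ) < p then (1 : ℝ) else 0) = p := by
  rw [Fin.sum_univ_eq_sum_range (fun i => if i < p then (1 : ℝ) else 0), Finset.sum_boole]
  congr 1
  rw [show (Finset.range n).filter (· < p) = Finset.range p by ext; simp; omega,
    Finset.card_range]

/-- Conjugation by `Q` with `R` a left inverse preserves products. -/
lemma conj_mul_conj {n : ℕ} {Q R : Matrix (Fin n) (Fin n) ℝ} (h : R * Q = 1)
    (A B : Matrix (Fin n) (Fin n) ℝ) : Q * A * R * (Q * B * R) = Q * (A * B) * R := by
  calc Q * A * R * (Q * B * R) = Q * A * (R * Q) * B * R := by simp only [Matrix.mul_assoc]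
    _ = Q * (A * B) * R := by rw [h, Matrix.mul_one, Matrix.mul_assoc Q A B]

lemma grass_conj_diagonal {n p : ℕ} (hpn : p ≤ n) {Q : Matrix (Fin n) (Fin n) ℝ}
    (hQ : Qᵀ * Q = 1) :
    Grass p (Q * Matrix.diagonal (fun i : Fin n => if (i : ℕ) < p then (1 : ℝ) else 0) * Qᵀ) := by
  have hid : Q * Matrix.diagonal (fun i : Fin n => if (i : ℕ) < p then (1 : ℝ) else 0) * Qᵀ *
      (Q * Matrix.diagonal (fun i : Fin n => if (i : ℕ) < p then (1 : ℝ) else 0) * Qᵀ) =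
      Q * Matrix.diagonal (fun i : Fin n => if (i : ℕ) < p then (1 : ℝ) else 0) * Qᵀ := by
    rw [conj_mul_conj hQ, Matrix.diagonal_mul_diagonal]
    congr 3
    funext i
    split_ifs <;> simp
  refine ⟨?_, hid, ?_⟩
  · simp [Matrix.IsSymm, Matrix.transpose_mul, Matrix.mul_assoc]
  · have h := trace_eq_rank_of_mul_self hid
    rw [Matrix.trace_mul_comm, ← Matrix.mul_assoc, hQ, Matrix.one_mul, Matrix.trace_diagonal,
      sum_indicator_lt hpn] at h
    exact_mod_cast h.symm

lemma trace_transpose_mul_self_sub {n p : ℕ} {X Y : Matrix (Fin n) (Fin n) ℝ} (hY : Y.IsSymm)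
    (hX : Grass p X) :
    ((Y - X)ᵀ * (Y - X)).trace = (Y * Y).trace - 2 * (Y * X).trace + p := by
  obtain ⟨hs, hi, hr⟩ := hX
  rw [Matrix.transpose_sub, hY.eq, hs.eq, Matrix.sub_mul, Matrix.mul_sub, Matrix.mul_sub, hi]
  simp only [Matrix.trace_sub]
  rw [Matrix.trace_mul_comm X Y, trace_eq_rank_of_mul_self hi, hr]
  ring

/-- Ky Fan's maximum principle for orthogonal projections of rank `p`. -/
lemma trace_mul_le_of_grass {n p : ℕ} (hpn : p ≤ n) {Q : Matrix (Fin n) (Fin n) ℝ}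
    (hQ : Qᵀ * Q = 1) {lam : Fin n → ℝ} (hlam : Antitone lam) {X : Matrix (Fin n) (Fin n) ℝ}
    (hX : Grass p X) :
    (Q * Matrix.diagonal lam * Qᵀ * X).trace ≤
      ∑ i : Fin n, lam i * if (i : ℕ) < p then (1 : ℝ) else 0 := by
  obtain ⟨hs, hi, hr⟩ := hX
  have hQ' : Q * Qᵀ = 1 := mul_eq_one_comm.1 hQ
  have hZs : (Qᵀ * X * Q).IsSymm := by
    simp [Matrix.IsSymm, Matrix.transpose_mul, Matrix.mul_assoc, hs.eq]
  have hZi : Qᵀ * X * Q * (Qᵀ * X * Q) = Qᵀ * X * Q := by rw [conj_mul_conj hQ', hi]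
  have hZt : ∑ i, (Qᵀ * X * Q) i i = ∑ i : Fin n, if (i : ℕ) < p then (1 : ℝ) else 0 := by
    rw [sum_indicator_lt hpn, ← hr, ← trace_eq_rank_of_mul_self hi]
    change (Qᵀ * X * Q).trace = _
    rw [Matrix.trace_mul_comm, ← Matrix.mul_assoc, hQ', Matrix.one_mul]
  have htr : (Q * Matrix.diagonal lam * Qᵀ * X).trace = ∑ i, lam i * (Qᵀ * X * Q) i i := by
    rw [Matrix.mul_assoc, Matrix.mul_assoc, Matrix.trace_mul_comm, Matrix.mul_assoc]
    simp [Matrix.trace, Matrix.diagonal_mul]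
  rw [htr]
  exact hlam.sum_mul_le_sum_mul_indicator (diag_mem_Icc_of_isSymm_of_mul_self hZs hZi) hZt

/-- Lemma 4.8(iii), existence part: if `Y = Q·diag(λ₁,…,λ_n)·Qᵀ` with `Q`
orthogonal and `λ₁ ≥ … ≥ λ_n`, then `X₀ = Q·diag(I_p,0)·Qᵀ` lies in `Gr(p,n)` and
is a best Frobenius-norm approximation of `Y` in `Gr(p,n)`. -/
theorem grassmann_projection_spectral {n p : ℕ} (hpn : p ≤ n)
    (Q : Matrix (Fin n) (Fin n) ℝ) (hQ : Qᵀ * Q = 1)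
    (lam : Fin n → ℝ) (hlam : Antitone lam)
    (Y : Matrix (Fin n) (Fin n) ℝ) (hYsymm : Y.IsSymm)
    (hY : Y = Q * Matrix.diagonal lam * Qᵀ) :
    Grass p (Q * Matrix.diagonal (fun i : Fin n => if (i : ℕ) < p then (1 : ℝ) else 0) * Qᵀ) ∧
    ∀ X, Grass p X →
      frobNorm (Y - Q * Matrix.diagonal (fun i : Fin n => if (i : ℕ) < p then (1 : ℝ) else 0) * Qᵀ)
        ≤ frobNorm (Y - X) := by
  have hX₀ := grass_conj_diagonal hpn hQ
  refine ⟨hX₀, fun X hX => Real.sqrt_le_sqrt ?_⟩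
  rw [trace_transpose_mul_self_sub hYsymm hX₀, trace_transpose_mul_self_sub hYsymm hX]
  have hle := trace_mul_le_of_grass hpn hQ hlam hX
  rw [← hY] at hle
  have heq : (Y * (Q * Matrix.diagonal (fun i : Fin n => if (i : ℕ) < p then (1 : ℝ) else 0) *
      Qᵀ)).trace = ∑ i : Fin n, lam i * if (i : ℕ) < p then (1 : ℝ) else 0 := by
    rw [hY, conj_mul_conj hQ, Matrix.trace_mul_comm, ← Matrix.mul_assoc, hQ, Matrix.one_mul,
      Matrix.diagonal_mul_diagonal, Matrix.trace_diagonal]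
  rw [heq]
  linarith
end

section
/- Let 1 ≤ r ≤ n and let Y ∈ ℝ^{n×r}. If there exists X ∈ ℝ^{n×r} with XᵀX = I_r and ‖Y − X‖ < 1 (Frobenius norm), then YᵀY is positive definite; in particular Y has full column rank r, and Y admits a unique orthogonal polar factor Y(YᵀY)^{−1/2}. -/
open Matrix

theorem Matrix.trace_transpose_mul_self_eq_sum_sq {m n : Type*} [Fintype m] [Fintype n]
    (A : Matrix m n ℝ) : (Aᵀ * A).trace = ∑ i, ∑ j, A i j ^ 2 := by
  simp only [trace, diag_apply, mul_apply, transpose_apply, ← pow_two]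
  exact Finset.sum_comm

/-- The Frobenius norm dominates the Euclidean operator norm. -/
theorem Matrix.mulVec_dotProduct_mulVec_le_trace {m n : Type*} [Fintype m] [Fintype n]
    (A : Matrix m n ℝ) (v : n → ℝ) :
    (A *ᵥ v) ⬝ᵥ (A *ᵥ v) ≤ (Aᵀ * A).trace * (v ⬝ᵥ v) := by
  rw [trace_transpose_mul_self_eq_sum_sq, Finset.sum_mul]
  simp only [dotProduct, mulVec, ← pow_two]
  exact Finset.sum_le_sum fun i _ => Finset.sum_mul_sq_le_sq_mul_sq _ _ _

theorem trace_transpose_mul_self_lt_one_of_frobNorm_lt_one {m n : ℕ}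
    {A : Matrix (Fin m) (Fin n) ℝ} (h : frobNorm A < 1) : (Aᵀ * A).trace < 1 := by
  rw [frobNorm, Real.sqrt_lt' one_pos] at h
  simpa using h

theorem Matrix.mulVec_dotProduct_mulVec_of_transpose_mul_self_eq_one {m n : Type*} [Fintype m]
    [Fintype n] [DecidableEq n] {X : Matrix m n ℝ} (hX : Xᵀ * X = 1) (v : n → ℝ) :
    (X *ᵥ v) ⬝ᵥ (X *ᵥ v) = v ⬝ᵥ v := by
  rw [dotProduct_mulVec, vecMul_mulVec, hX, vecMul_one]

theorem mulVec_injective_of_frobNorm_sub_lt_one {m n : ℕ} {X Y : Matrix (Fin m) (Fin n) ℝ}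
    (hX : Xᵀ * X = 1) (h : frobNorm (Y - X) < 1) : Function.Injective Y.mulVec := by
  refine (injective_iff_map_eq_zero Y.mulVecLin).2 fun v hv => ?_
  rw [mulVecLin_apply] at hv
  have hle := (Y - X).mulVec_dotProduct_mulVec_le_trace v
  rw [sub_mulVec, hv, zero_sub, neg_dotProduct_neg,
    mulVec_dotProduct_mulVec_of_transpose_mul_self_eq_one hX] at hle
  have hnonneg : 0 ≤ v ⬝ᵥ v := Finset.sum_nonneg fun i _ => mul_self_nonneg (v i)
  have hlt := trace_transpose_mul_self_lt_one_of_frobNorm_lt_one h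
  exact dotProduct_self_eq_zero.1 (by nlinarith)

/-- Example 4.4 (key claim): if `Y ∈ ℝ^{n×r}` lies within Frobenius distance `1`
of the Stiefel manifold `St(r,n)`, then `YᵀY` is positive definite; in particular
`Y` has full column rank `r`. -/
theorem posDef_of_close_to_stiefel {n r : ℕ} (hr : 1 ≤ r) (hrn : r ≤ n)
    (Y : Matrix (Fin n) (Fin r) ℝ)
    (h : ∃ X : Matrix (Fin n) (Fin r) ℝ, Xᵀ * X = 1 ∧ frobNorm (Y - X) < 1) :
    (Yᵀ * Y).PosDef ∧ Y.rank = r := by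
  obtain ⟨X, hX, hYX⟩ := h
  have hpos : (Yᵀ * Y).PosDef := by
    rw [← conjTranspose_eq_transpose_of_trivial]
    exact PosDef.conjTranspose_mul_self Y (mulVec_injective_of_frobNorm_sub_lt_one hX hYX)
  refine ⟨hpos, ?_⟩
  rw [← rank_transpose_mul_self, rank_of_isUnit _ hpos.isUnit, Fintype.card_fin]
end

section
/- Let η̄ ∈ [0,1), let (η_k)_{k≥0} be a sequence with 0 ≤ η_k ≤ η̄ for all k, let (f_k)_{k≥0} be real numbers and (ε_k)_{k≥0} nonnegative real numbers. Define q₀ = 1, q_{k+1} = η_k q_k + 1, c₀ = f₀, c_{k+1} = (η_k q_k c_k + f_{k+1}) / q_{k+1}. Assume f_{k+1} ≤ c_k − ε_k for all k ≥ 0, and that there exists f* ∈ ℝ with f_k ≥ f* for all k ≥ 0. Then for every K ∈ ℕ: (1 − η̄) · Σ_{k=0}^{K} ε_k ≤ f₀ − f*. In particular Σ_{k=0}^{∞} ε_k converges and min_{0≤k≤K} ε_k ≤ (f₀ − f*) / ((1−η̄)(K+1)). -/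
/-- The Zhang–Hager weights satisfy `1 ≤ q k` and `(1 - a) * q k ≤ 1` when the mixing parameters lie
in `[0, a]`. -/
theorem zhang_hager_weight_bounds {a : ℝ} {η q : ℕ → ℝ}
    (hη : ∀ k, 0 ≤ η k ∧ η k ≤ a) (hq0 : q 0 = 1) (hq : ∀ k, q (k + 1) = η k * q k + 1) (k : ℕ) :
    1 ≤ q k ∧ (1 - a) * q k ≤ 1 := by
  induction k with
  | zero =>
    have := (hη 0).1.trans (hη 0).2
    rw [hq0]
    constructor <;> linarith
  | succ k ih =>
    obtain ⟨h1, h2⟩ := ih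
    obtain ⟨h3, h4⟩ := hη k
    rw [hq]
    have h5 : 0 ≤ η k * q k := mul_nonneg h3 (by linarith)
    have h6 : η k * ((1 - a) * q k) ≤ η k * 1 := mul_le_mul_of_nonneg_left h2 h3
    constructor <;> linarith

/-- Quantitative core of Theorem 6.3 (iteration complexity for the Zhang–Hager
nonmonotone Armijo scheme), as a real-sequence lemma. -/
theorem zhang_hager_complexity
    (ηbar : ℝ) (hηbar0 : 0 ≤ ηbar) (hηbar1 : ηbar < 1)
    (η f ε q c : ℕ → ℝ)
    (hη : ∀ k, 0 ≤ η k ∧ η k ≤ ηbar)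
    (hε : ∀ k, 0 ≤ ε k)
    (hq0 : q 0 = 1) (hqrec : ∀ k, q (k + 1) = η k * q k + 1)
    (hc0 : c 0 = f 0)
    (hcrec : ∀ k, c (k + 1) = (η k * q k * c k + f (k + 1)) / q (k + 1))
    (hdec : ∀ k, f (k + 1) ≤ c k - ε k)
    (fstar : ℝ) (hfstar : ∀ k, fstar ≤ f k) :
    (∀ K : ℕ, (1 - ηbar) * ∑ k ∈ Finset.range (K + 1), ε k ≤ f 0 - fstar) ∧
    Summable ε ∧
    (∀ K : ℕ, ∃ k ≤ K, ε k ≤ (f 0 - fstar) / ((1 - ηbar) * ((K : ℝ) + 1))) := by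
  have hqb := zhang_hager_weight_bounds hη hq0 hqrec
  have hpos : 0 < 1 - ηbar := sub_pos.2 hηbar1
  have hc : ∀ k, fstar ≤ c k := by
    intro k
    induction k with
    | zero => exact hc0 ▸ hfstar 0
    | succ k ih =>
      have hq := (hqb (k + 1)).1
      rw [hcrec, le_div_iff₀ (by linarith), hqrec]
      have := mul_le_mul_of_nonneg_left ih
        (mul_nonneg (hη k).1 (zero_le_one.trans (hqb k).1))
      linarith [hfstar (k + 1)]
  have hstep : ∀ k, (1 - ηbar) * ε k ≤ c k - c (k + 1) := by
    intro k
    have hq : 0 < q (k + 1) := by linarith [(hqb (k + 1)).1]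
    have hdiff : c k - c (k + 1) = (c k - f (k + 1)) / q (k + 1) := by
      rw [hcrec, eq_div_iff hq.ne', sub_mul, div_mul_cancel₀ _ hq.ne', hqrec]
      ring
    rw [hdiff, le_div_iff₀ hq]
    have := mul_le_mul_of_nonneg_right (hqb (k + 1)).2 (hε k)
    linarith [hdec k]
  have hsum : ∀ n, (1 - ηbar) * ∑ k ∈ Finset.range n, ε k ≤ f 0 - fstar := by
    intro n
    calc (1 - ηbar) * ∑ k ∈ Finset.range n, ε k
        ≤ ∑ k ∈ Finset.range n, (c k - c (k + 1)) := by
          rw [Finset.mul_sum]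
          exact Finset.sum_le_sum fun k _ => hstep k
      _ = f 0 - c n := by rw [Finset.sum_range_sub', hc0]
      _ ≤ f 0 - fstar := by linarith [hc n]
  refine ⟨fun K => hsum (K + 1), ?_, fun K => ?_⟩
  · refine summable_of_sum_range_le (c := (f 0 - fstar) / (1 - ηbar)) hε fun n => ?_
    rw [le_div_iff₀' hpos]
    exact hsum n
  · by_contra! h
    have hlt : ∑ _k ∈ Finset.range (K + 1), (f 0 - fstar) / ((1 - ηbar) * ((K : ℝ) + 1))
        < ∑ k ∈ Finset.range (K + 1), ε k :=
      Finset.sum_lt_sum_of_nonempty Finset.nonempty_range_add_one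
        fun k hk => h k (Nat.lt_succ_iff.1 (Finset.mem_range.1 hk))
    have hK : (0 : ℝ) < (K : ℝ) + 1 := by positivity
    have heq : (1 - ηbar) * ∑ _k ∈ Finset.range (K + 1),
        (f 0 - fstar) / ((1 - ηbar) * ((K : ℝ) + 1)) = f 0 - fstar := by
      rw [Finset.sum_const, Finset.card_range, nsmul_eq_mul]
      push_cast
      field_simp
    linarith [mul_lt_mul_of_pos_left hlt hpos, hsum (K + 1)]
end

section
/- Let m ≥ 1, let g : ℝ^m → ℝ be differentiable with continuous gradient ∇g, let (x_k)_{k≥0} be a sequence in ℝ^m having an accumulation point x* (some subsequence of (x_k) converges to x*), and let (c_k)_{k≥0} be a non-increasing sequence of real numbers with g(x_k) ≤ c_k for all k. Assume: (i) there exist constants κ, ψ > 0 such that c_k − c_{k+1} ≥ κ‖∇g(x_k)‖² + ψ‖x_{k+1} − x_k‖² for all k; (ii) there exist θ ∈ [1/2, 1), ς > 0 and ε > 0 such that |g(y) − g(x*)|^θ ≤ ς‖∇g(y)‖ for all y with ‖y − x*‖ < ε (a Łojasiewicz gradient inequality at x* with exponent θ); and (iii) Σ_{k=0}^{∞} (c_k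 − g(x_k))^θ < ∞. Then the whole sequence (x_k) converges to x*, and ∇g(x*) = 0. -/
open Filter

/-- If each step taken near `a` is bounded by the decrease of a nonnegative potential that tends to
zero, and `a` is an accumulation point, then the whole sequence converges to `a`. -/
theorem tendsto_of_dist_le_potential_sub {E : Type*} [PseudoMetricSpace E] {x : ℕ → E} {a : E}
    {φ : ℕ → ℕ} (hφ : StrictMono φ) (hx : Tendsto (fun k => x (φ k)) atTop (nhds a))
    {p : ℕ → ℝ} (hp0 : ∀ k, 0 ≤ p k) (hp : Tendsto p atTop (nhds 0)) {ε : ℝ} (hε : 0 < ε)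
    (hstep : ∀ k, dist (x k) a < ε → dist (x (k + 1)) (x k) ≤ p k - p (k + 1)) :
    Tendsto x atTop (nhds a) := by
  rw [Metric.tendsto_atTop]
  intro δ hδ
  have hlim : Tendsto (fun k => dist (x (φ k)) a + p (φ k)) atTop (nhds 0) := by
    simpa using (tendsto_iff_dist_tendsto_zero.1 hx).add (hp.comp hφ.tendsto_atTop)
  obtain ⟨j, hj⟩ := (hlim.eventually_lt_const (lt_min hδ hε)).exists
  have key : ∀ k, φ j ≤ k → dist (x k) a + p k < min δ ε := by
    intro k hk
    induction k, hk using Nat.le_induction with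
    | base => exact hj
    | succ k _ ih =>
      have h := hstep k (by linarith [min_le_right δ ε, hp0 k])
      linarith [dist_triangle (x (k + 1)) (x k) a]
  exact ⟨φ j, fun k hk => by linarith [key k hk, min_le_left δ ε, hp0 k]⟩

/-- Concavity of `t ↦ t ^ (1 - θ)`, in a form without division. -/
theorem one_sub_mul_sub_le_rpow_mul_rpow_sub {a b θ : ℝ} (ha : 0 ≤ a) (hb : 0 ≤ b)
    (h0 : 0 ≤ θ) (h1 : θ ≤ 1) :
    (1 - θ) * (a - b) ≤ a ^ θ * (a ^ (1 - θ) - b ^ (1 - θ)) := by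
  have h := Real.geom_mean_le_arith_mean2_weighted h0 (sub_nonneg.2 h1) ha hb (by ring)
  have h' : a ^ θ * a ^ (1 - θ) = a := by
    rw [← Real.rpow_add' ha (by simp)]
    simp
  rw [mul_sub (a ^ θ), h']
  linarith

/-- A quadratic bound with a bilinear right-hand side yields a linear bound on `D`. -/
theorem le_add_mul_of_sq_add_sq_le {κ ψ ς d G D Δ : ℝ} (hκ : 0 < κ) (hψ : 0 < ψ) (hς : 0 < ς)
    (hd : 0 ≤ d) (hΔ : 0 ≤ Δ) (h : κ * G ^ 2 + ψ * D ^ 2 ≤ (d + ς * G) * Δ) :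
    D ≤ d + (1 / ψ + ς ^ 2 / κ) * Δ := by
  have hM : 0 ≤ 1 / ψ + ς ^ 2 / κ := by positivity
  refine abs_le_of_sq_le_sq' ?_ (by positivity) |>.2
  have hG : ψ * D ^ 2 ≤ d * Δ + ς ^ 2 / κ / 4 * Δ ^ 2 := by
    have hsq : 0 ≤ κ * (G - ς / κ / 2 * Δ) ^ 2 := by positivity
    have hexp : κ * (G - ς / κ / 2 * Δ) ^ 2
        = κ * G ^ 2 - ς * G * Δ + ς ^ 2 / κ / 4 * Δ ^ 2 := by
      field_simp
      ring
    linarith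
  refine le_of_mul_le_mul_left (hG.trans ?_) hψ
  have hexp : ψ * (d + (1 / ψ + ς ^ 2 / κ) * Δ) ^ 2
      = ψ * d ^ 2 + 2 * d * Δ + 2 * (ψ * (ς ^ 2 / κ)) * d * Δ + 1 / ψ * Δ ^ 2
        + 2 * (ς ^ 2 / κ) * Δ ^ 2 + ψ * (ς ^ 2 / κ) ^ 2 * Δ ^ 2 := by
    field_simp
    ring
  have h1 : 0 ≤ ψ * d ^ 2 := by positivity
  have h2 : 0 ≤ d * Δ := by positivity
  have h3 : 0 ≤ 2 * (ψ * (ς ^ 2 / κ)) * d * Δ := by positivity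
  have h4 : 0 ≤ 1 / ψ * Δ ^ 2 := by positivity
  have h5 : 0 ≤ ς ^ 2 / κ * Δ ^ 2 := by positivity
  have h6 : 0 ≤ ψ * (ς ^ 2 / κ) ^ 2 * Δ ^ 2 := by positivity
  linarith

/-- Euclidean-space version of Lemma 6.4: global convergence of a sequence under
a nonmonotone sufficient-decrease condition with reference values `c_k`, a
Łojasiewicz gradient inequality at an accumulation point `x*`, and summability of
`(c_k − g(x_k))^θ`. Then the whole sequence converges to `x*`, which is a
stationary point of `g`. -/
theorem nonmonotone_global_convergence {m : ℕ} (hm : 1 ≤ m)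
    (g : EuclideanSpace ℝ (Fin m) → ℝ)
    (hdiff : ∀ y, DifferentiableAt ℝ g y)
    (hcont : Continuous fun y => gradient g y)
    (x : ℕ → EuclideanSpace ℝ (Fin m)) (xstar : EuclideanSpace ℝ (Fin m))
    (hacc : ∃ φ : ℕ → ℕ, StrictMono φ ∧
      Tendsto (fun k => x (φ k)) atTop (nhds xstar))
    (c : ℕ → ℝ) (hcmono : ∀ k, c (k + 1) ≤ c k) (hgc : ∀ k, g (x k) ≤ c k)
    (κ ψ : ℝ) (hκ : 0 < κ) (hψ : 0 < ψ)
    (hdesc : ∀ k, κ * ‖gradient g (x k)‖ ^ 2 + ψ * ‖x (k + 1) - x k‖ ^ 2 ≤ c k - c (k + 1))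
    (θ ς ε : ℝ) (hθ1 : 1 / 2 ≤ θ) (hθ2 : θ < 1) (hς : 0 < ς) (hε : 0 < ε)
    (hKL : ∀ y, ‖y - xstar‖ < ε → |g y - g xstar| ^ θ ≤ ς * ‖gradient g y‖)
    (hsum : Summable fun k => (c k - g (x k)) ^ θ) :
    Tendsto x atTop (nhds xstar) ∧ gradient g xstar = 0 := by
  obtain ⟨φ, hφ, hx⟩ := hacc
  have hθ0 : 0 < θ := by linarith
  have hgap0 : ∀ k, 0 ≤ c k - g (x k) := fun k => sub_nonneg.2 (hgc k)
  have hd0 : ∀ k, 0 ≤ (c k - g (x k)) ^ θ := fun k => Real.rpow_nonneg (hgap0 k) θ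
  have hanti : Antitone c := antitone_nat_of_succ_le hcmono
  have hgap : Tendsto (fun k => c k - g (x k)) atTop (nhds 0) := by
    have h := hsum.tendsto_atTop_zero.rpow_const (p := θ⁻¹) (Or.inr (by positivity))
    rw [Real.zero_rpow (by positivity)] at h
    exact h.congr fun k => Real.rpow_rpow_inv (hgap0 k) hθ0.ne'
  have hc : Tendsto c atTop (nhds (g xstar)) := by
    rw [tendsto_iff_tendsto_subseq_of_antitone hanti hφ.tendsto_atTop]
    have hgx := (hdiff xstar).continuousAt.tendsto.comp hx
    have h := (hgap.comp hφ.tendsto_atTop).add hgx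
    rw [zero_add] at h
    exact h.congr fun k => by simp
  have hr0 : ∀ k, 0 ≤ c k - g xstar := fun k => sub_nonneg.2 (hanti.le_of_tendsto hc k)
  have hr : Tendsto (fun k => c k - g xstar) atTop (nhds 0) := by
    simpa using hc.sub_const (g xstar)
  have hgrad : Tendsto (fun k => gradient g (x k)) atTop (nhds 0) := by
    have hdec : Tendsto (fun k => (c k - c (k + 1)) / κ) atTop (nhds 0) := by
      simpa using (hc.sub (hc.comp (tendsto_add_atTop_nat 1))).div_const κ
    have hsq : Tendsto (fun k => ‖gradient g (x k)‖ ^ 2) atTop (nhds 0) := by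
      refine squeeze_zero (fun k => by positivity) (fun k => ?_) hdec
      rw [le_div_iff₀ hκ]
      have : 0 ≤ ψ * ‖x (k + 1) - x k‖ ^ 2 := by positivity
      linarith [hdesc k]
    rw [tendsto_zero_iff_norm_tendsto_zero]
    simpa using hsq.sqrt
  refine ⟨?_, tendsto_nhds_unique ((hcont.tendsto xstar).comp hx) (hgrad.comp hφ.tendsto_atTop)⟩
  set M : ℝ := (1 / ψ + ς ^ 2 / κ) / (1 - θ) with hM
  have hθ' : 0 < 1 - θ := by linarith
  have hM0 : 0 ≤ M := by positivity
  refine tendsto_of_dist_le_potential_sub hφ hx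
    (p := fun k => M * (c k - g xstar) ^ (1 - θ)
      + (∑' j, (c j - g (x j)) ^ θ - ∑ j ∈ Finset.range k, (c j - g (x j)) ^ θ))
    (fun k => ?_) ?_ hε fun k hk => ?_
  · exact add_nonneg (mul_nonneg hM0 (Real.rpow_nonneg (hr0 k) _))
      (sub_nonneg.2 (hsum.sum_le_tsum _ fun j _ => hd0 j))
  · have h1 := hr.rpow_const (p := 1 - θ) (Or.inr hθ'.le)
    rw [Real.zero_rpow hθ'.ne'] at h1
    simpa using (h1.const_mul M).add (hsum.hasSum.tendsto_sum_nat.const_sub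
      (∑' j, (c j - g (x j)) ^ θ))
  · rw [dist_eq_norm] at hk ⊢
    have hsplit : (c k - g xstar) ^ θ ≤ (c k - g (x k)) ^ θ + ς * ‖gradient g (x k)‖ :=
      calc (c k - g xstar) ^ θ ≤ ((c k - g (x k)) + |g (x k) - g xstar|) ^ θ :=
            Real.rpow_le_rpow (hr0 k) (by linarith [le_abs_self (g (x k) - g xstar)]) hθ0.le
        _ ≤ (c k - g (x k)) ^ θ + |g (x k) - g xstar| ^ θ :=
            Real.rpow_add_le_add_rpow (hgap0 k) (abs_nonneg _) hθ0.le hθ2.le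
        _ ≤ _ := by gcongr; exact hKL _ hk
    have hΔ0 : 0 ≤ (c k - g xstar) ^ (1 - θ) - (c (k + 1) - g xstar) ^ (1 - θ) :=
      sub_nonneg.2 (Real.rpow_le_rpow (hr0 _) (by linarith [hcmono k]) hθ'.le)
    have hconc := one_sub_mul_sub_le_rpow_mul_rpow_sub (hr0 k) (hr0 (k + 1)) hθ0.le hθ2.le
    have hbound := hconc.trans (mul_le_mul_of_nonneg_right hsplit hΔ0)
    have hquad := (hdesc k).trans (show c k - c (k + 1) ≤
        ((c k - g (x k)) ^ θ + ς * ‖gradient g (x k)‖)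
          * (((c k - g xstar) ^ (1 - θ) - (c (k + 1) - g xstar) ^ (1 - θ)) / (1 - θ)) by
      rw [← mul_div_assoc, le_div_iff₀ hθ']
      linarith)
    have hD := le_add_mul_of_sq_add_sq_le hκ hψ hς (hd0 k) (div_nonneg hΔ0 hθ'.le) hquad
    rw [mul_div_left_comm, ← hM] at hD
    rw [Finset.sum_range_succ]
    linarith
end
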